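/- arXiv:2508.02983 — 5 statements merged into one kernel-verified Lean document; each statement's English description precedes it below -/
import Mathlib

section
/- Let ((A, ∘), N) be a Nijenhuis pre-Lie algebra over a field K, let (V, ρ, φ) be a representation of (A, ∘), and let α : V → V be a linear map. Define on A⊕V the product (x+u) ∘_♡ (y+v) := x∘y + ρ(x)v + φ(y)u and the linear map N_{A⊕V}(x+v) := N(x) + α(v). Then (A⊕V, ∘_♡, N_{A⊕V}) is a Nijenhuis pre-Lie algebra if and only if ((V, ρ, φ), α) is a representation of ((A, ∘), N), i.e., ρ(N(x))α(v) + α²(ρ(x)v) = α(ρ(N(x))v) + α(ρ(x)α(v)) and φ(N(x))α(v) + α²(φ(x)v) = α(φ(N(x))v) + α(φ(x)α(v)) for all x ∈ A, v ∈ V. -/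
open TensorProduct LinearMap

noncomputable section

section Defs

variable (K A : Type*) [Field K] [AddCommGroup A] [Module K A]

/-- The flip map on `A ⊗ A`. -/
def flipT : A ⊗[K] A →ₗ[K] A ⊗[K] A := (TensorProduct.comm K A A).toLinearMap

/-- Swap the first two tensor factors of `A ⊗ (A ⊗ A)`. -/
def swap12 : A ⊗[K] (A ⊗[K] A) →ₗ[K] A ⊗[K] (A ⊗[K] A) :=
  (TensorProduct.assoc K A A A).toLinearMap ∘ₗ
    (TensorProduct.map (flipT K A) LinearMap.id) ∘ₗ
      (TensorProduct.assoc K A A A).symm.toLinearMap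

/-- Cyclic permutation `a ⊗ b ⊗ c ↦ c ⊗ a ⊗ b` on `A ⊗ (A ⊗ A)`. -/
def cyc : A ⊗[K] (A ⊗[K] A) →ₗ[K] A ⊗[K] (A ⊗[K] A) :=
  (TensorProduct.comm K (A ⊗[K] A) A).toLinearMap ∘ₗ
    (TensorProduct.assoc K A A A).symm.toLinearMap

variable {K A}

/-- `coassoc1 Δ δ x = x₍₁₎₍₁'₎ ⊗ x₍₁₎₍₂'₎ ⊗ x₍₂₎`, applying `δ` to the first Sweedler leg of `Δ`. -/
def coassoc1 (Δ δ : A →ₗ[K] A ⊗[K] A) : A →ₗ[K] A ⊗[K] (A ⊗[K] A) :=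
  (TensorProduct.assoc K A A A).toLinearMap ∘ₗ (TensorProduct.map δ LinearMap.id) ∘ₗ Δ

/-- `coassoc2 Δ δ x = x₍₁₎ ⊗ x₍₂₎₍₁'₎ ⊗ x₍₂₎₍₂'₎`, applying `δ` to the second Sweedler leg of `Δ`. -/
def coassoc2 (Δ δ : A →ₗ[K] A ⊗[K] A) : A →ₗ[K] A ⊗[K] (A ⊗[K] A) :=
  (TensorProduct.map LinearMap.id δ) ∘ₗ Δ

/-- The (left) pre-Lie identity for a bilinear multiplication. -/
def IsPreLie (m : A →ₗ[K] A →ₗ[K] A) : Prop :=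
  ∀ x y z : A, m (m x y) z - m x (m y z) = m (m y x) z - m y (m x z)

/-- The pre-Lie coalgebra identity for a comultiplication. -/
def IsPreLieCo (Δ : A →ₗ[K] A ⊗[K] A) : Prop :=
  ∀ x : A, coassoc1 Δ Δ x - coassoc2 Δ Δ x
    = swap12 K A (coassoc1 Δ Δ x) - swap12 K A (coassoc2 Δ Δ x)

/-- Equation (2.2) of a pre-Lie bialgebra. -/
def BialgEq1 (m : A →ₗ[K] A →ₗ[K] A) (Δ : A →ₗ[K] A ⊗[K] A) : Prop :=
  ∀ x y : A, Δ (m x y) - Δ (m y x)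
    = rTensor A (m x) (Δ y) + lTensor A (m x) (Δ y) - lTensor A (m.flip x) (Δ y)
      - rTensor A (m y) (Δ x) - lTensor A (m y) (Δ x) + lTensor A (m.flip y) (Δ x)

/-- Equation (2.3) of a pre-Lie bialgebra. -/
def BialgEq2 (m : A →ₗ[K] A →ₗ[K] A) (Δ : A →ₗ[K] A ⊗[K] A) : Prop :=
  ∀ x y : A, Δ (m x y) - flipT K A (Δ (m x y))
    = lTensor A (m.flip y) (Δ x) + lTensor A (m x) (Δ y)
      - flipT K A (rTensor A (m x) (Δ y)) - flipT K A (lTensor A (m.flip y) (Δ x))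
      - flipT K A (lTensor A (m x) (Δ y)) + rTensor A (m x) (Δ y)

/-- `(A, m, Δ)` is a pre-Lie bialgebra. -/
def IsPreLieBialg (m : A →ₗ[K] A →ₗ[K] A) (Δ : A →ₗ[K] A ⊗[K] A) : Prop :=
  IsPreLie m ∧ IsPreLieCo Δ ∧ BialgEq1 m Δ ∧ BialgEq2 m Δ

/-- The linear form on `A ⊗ A` given by `u ⊗ v ↦ f u * g v`. -/
def pairForm (f g : A →ₗ[K] K) : A ⊗[K] A →ₗ[K] K :=
  TensorProduct.lift ((LinearMap.mul K K).compl₁₂ f g)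

/-- The co-S-equation for a bilinear form `ω` on a pre-Lie coalgebra `(A, Δ)`. -/
def IsCoSEq (Δ : A →ₗ[K] A ⊗[K] A) (ω : A →ₗ[K] A →ₗ[K] K) : Prop :=
  ∀ x y z : A,
    pairForm (ω x) (ω.flip z) (Δ y) + pairForm (ω x) (ω y) (Δ z)
      = pairForm (ω.flip y) (ω.flip z) (Δ x) + pairForm (ω y) (ω x) (Δ z)

/-- The multiplication `x ∘_ω y = x₍₁₎ ω(x₍₂₎, y) + y₍₁₎ ω(x, y₍₂₎) − ω(x, y₍₁₎) y₍₂₎`. -/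
def omul (Δ : A →ₗ[K] A ⊗[K] A) (ω : A →ₗ[K] A →ₗ[K] K) : A →ₗ[K] A →ₗ[K] A :=
  TensorProduct.lift ((LinearMap.smulRightₗ ∘ₗ ω).flip) ∘ₗ Δ
  + (TensorProduct.lift ((LinearMap.smulRightₗ ∘ₗ ω.flip).flip) ∘ₗ Δ).flip
  - (TensorProduct.lift (LinearMap.smulRightₗ ∘ₗ ω.flip) ∘ₗ Δ).flip

/-- `N` is a Nijenhuis operator on the (pre-)Lie algebra `(A, m)`. -/
def IsNijenhuis (m : A →ₗ[K] A →ₗ[K] A) (N : A →ₗ[K] A) : Prop :=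
  ∀ x y : A, m (N x) (N y) + N (N (m x y)) = N (m (N x) y) + N (m x (N y))

/-- `S` is a Nijenhuis operator on the (pre-)Lie coalgebra `(A, Δ)`. -/
def IsNijenhuisCo (Δ : A →ₗ[K] A ⊗[K] A) (S : A →ₗ[K] A) : Prop :=
  ∀ x : A, TensorProduct.map S S (Δ x) + Δ (S (S x))
    = rTensor A S (Δ (S x)) + lTensor A S (Δ (S x))

/-- The 2-cocycle (pseudo-Hessian) condition for a bilinear form on a pre-Lie algebra. -/
def IsHessian (m : A →ₗ[K] A →ₗ[K] A) (ω : A →ₗ[K] A →ₗ[K] K) : Prop :=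
  ∀ x y z : A, ω (m x y) z - ω x (m y z) = ω (m y x) z - ω y (m x z)

/-- The multiplication `A ⊗ A →ₗ A` induced by a bilinear multiplication. -/
def mhat (m : A →ₗ[K] A →ₗ[K] A) : A ⊗[K] A →ₗ[K] A := TensorProduct.lift m

variable (K A) in
/-- The middle-four exchange `(a ⊗ b) ⊗ (c ⊗ d) ↦ (a ⊗ c) ⊗ (b ⊗ d)` as a linear map. -/
def ttc : (A ⊗[K] A) ⊗[K] (A ⊗[K] A) →ₗ[K] (A ⊗[K] A) ⊗[K] (A ⊗[K] A) :=
  (TensorProduct.tensorTensorTensorComm K A A A A).toLinearMap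

/-- `(aᵢ ⊗ bᵢ) ⊗ (aⱼ ⊗ bⱼ) ↦ aᵢ ⊗ (bᵢ∘aⱼ) ⊗ bⱼ`. -/
def sTerm1 (m : A →ₗ[K] A →ₗ[K] A) :
    (A ⊗[K] A) ⊗[K] (A ⊗[K] A) →ₗ[K] A ⊗[K] (A ⊗[K] A) :=
  lTensor A (rTensor A (mhat m)) ∘ₗ
    lTensor A (TensorProduct.assoc K A A A).symm.toLinearMap ∘ₗ
      (TensorProduct.assoc K A A (A ⊗[K] A)).toLinearMap

/-- `(aᵢ ⊗ bᵢ) ⊗ (aⱼ ⊗ bⱼ) ↦ aᵢ ⊗ aⱼ ⊗ (bᵢ∘bⱼ)`. -/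
def sTerm2 (m : A →ₗ[K] A →ₗ[K] A) :
    (A ⊗[K] A) ⊗[K] (A ⊗[K] A) →ₗ[K] A ⊗[K] (A ⊗[K] A) :=
  lTensor A (lTensor A (mhat m) ∘ₗ swap12 K A) ∘ₗ
    (TensorProduct.assoc K A A (A ⊗[K] A)).toLinearMap

/-- `(aᵢ ⊗ bᵢ) ⊗ (aⱼ ⊗ bⱼ) ↦ (aᵢ∘aⱼ) ⊗ bᵢ ⊗ bⱼ`. -/
def sTerm3 (m : A →ₗ[K] A →ₗ[K] A) :
    (A ⊗[K] A) ⊗[K] (A ⊗[K] A) →ₗ[K] A ⊗[K] (A ⊗[K] A) :=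
  rTensor (A ⊗[K] A) (mhat m) ∘ₗ ttc K A

/-- `(aᵢ ⊗ bᵢ) ⊗ (aⱼ ⊗ bⱼ) ↦ aᵢ ⊗ aⱼ ⊗ (bⱼ∘bᵢ)`. -/
def sTerm4 (m : A →ₗ[K] A →ₗ[K] A) :
    (A ⊗[K] A) ⊗[K] (A ⊗[K] A) →ₗ[K] A ⊗[K] (A ⊗[K] A) :=
  lTensor A (lTensor A (mhat m ∘ₗ flipT K A)) ∘ₗ
    (TensorProduct.assoc K A A (A ⊗[K] A)).toLinearMap ∘ₗ ttc K A

/-- `r` is a solution of the S-equation in the pre-Lie algebra `(A, m)`. -/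
def IsSEq (m : A →ₗ[K] A →ₗ[K] A) (r : A ⊗[K] A) : Prop :=
  sTerm1 m (r ⊗ₜ[K] r) + sTerm2 m (r ⊗ₜ[K] r)
    = sTerm3 m (r ⊗ₜ[K] r) + sTerm4 m (r ⊗ₜ[K] r)

/-- The comultiplication `Δ_r(x) = x∘aᵢ ⊗ bᵢ + aᵢ ⊗ x∘bᵢ − aᵢ ⊗ bᵢ∘x`. -/
def coprodR (m : A →ₗ[K] A →ₗ[K] A) (r : A ⊗[K] A) : A →ₗ[K] A ⊗[K] A :=
  (rTensorHom (M := A) ∘ₗ m).flip r + (lTensorHom (M := A) ∘ₗ m).flip r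
    - (lTensorHom (M := A) ∘ₗ m.flip).flip r

/-- The Nijenhuis pre-Lie algebra `((A, m), N)` is `S`-admissible. -/
def IsAdmissible (m : A →ₗ[K] A →ₗ[K] A) (N S : A →ₗ[K] A) : Prop :=
  (∀ x y : A, S (m (N x) y) + m x (S (S y)) = m (N x) (S y) + S (m x (S y))) ∧
  (∀ x y : A, S (m x (N y)) + m (S (S x)) y = m (S x) (N y) + S (m (S x) y))

/-- `((A*, Δ*), S*)` is `N*`-admissible, written on `A`. -/
def IsCoAdmissible (Δ : A →ₗ[K] A ⊗[K] A) (N S : A →ₗ[K] A) : Prop :=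
  (∀ x : A, lTensor A S (Δ (N x)) + rTensor A (N ∘ₗ N) (Δ x)
      = TensorProduct.map N S (Δ x) + rTensor A N (Δ (N x))) ∧
  (∀ x : A, rTensor A S (Δ (N x)) + lTensor A (N ∘ₗ N) (Δ x)
      = TensorProduct.map S N (Δ x) + lTensor A N (Δ (N x)))

/-- `(A, m, Δ, N, S)` is a Nijenhuis pre-Lie bialgebra. -/
def IsNijPreLieBialg (m : A →ₗ[K] A →ₗ[K] A) (Δ : A →ₗ[K] A ⊗[K] A)
    (N S : A →ₗ[K] A) : Prop :=
  IsPreLie m ∧ IsNijenhuis m N ∧ IsPreLieCo Δ ∧ IsNijenhuisCo Δ S ∧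
    BialgEq1 m Δ ∧ BialgEq2 m Δ ∧ IsAdmissible m N S ∧ IsCoAdmissible Δ N S

/-- The pre-Lie bialgebra `(A, m, Δ)` is balanced. -/
def IsBalanced (m : A →ₗ[K] A →ₗ[K] A) (Δ : A →ₗ[K] A ⊗[K] A) : Prop :=
  ∀ x y : A, rTensor A (m.flip y) (Δ x) + flipT K A (rTensor A (m.flip x) (Δ y))
    = rTensor A (m.flip x) (Δ y) + flipT K A (rTensor A (m.flip y) (Δ x))

/-- `(A, b)` is a Lie algebra. -/
def IsLieBracket (b : A →ₗ[K] A →ₗ[K] A) : Prop :=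
  (∀ x : A, b x x = 0) ∧
  (∀ x y z : A, b (b x y) z + b (b y z) x + b (b z x) y = 0)

/-- `(A, d)` is a Lie coalgebra. -/
def IsLieCobracket (d : A →ₗ[K] A ⊗[K] A) : Prop :=
  (∀ x : A, d x = - flipT K A (d x)) ∧
  (∀ x : A, coassoc2 d d x + cyc K A (coassoc2 d d x) + cyc K A (cyc K A (coassoc2 d d x)) = 0)

/-- `(A, b, d)` is a Lie bialgebra. -/
def IsLieBialg (b : A →ₗ[K] A →ₗ[K] A) (d : A →ₗ[K] A ⊗[K] A) : Prop :=
  IsLieBracket b ∧ IsLieCobracket d ∧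
    ∀ x y : A, d (b x y)
      = rTensor A (b x) (d y) + lTensor A (b x) (d y)
        - rTensor A (b y) (d x) - lTensor A (b y) (d x)

/-- `(A, b, d, N, S)` is a Nijenhuis Lie bialgebra. -/
def IsNijLieBialg (b : A →ₗ[K] A →ₗ[K] A) (d : A →ₗ[K] A ⊗[K] A)
    (N S : A →ₗ[K] A) : Prop :=
  IsLieBialg b d ∧ IsNijenhuis b N ∧ IsNijenhuisCo d S ∧
  (∀ x y : A, S (b (N x) y) + b x (S (S y)) = b (N x) (S y) + S (b x (S y))) ∧
  (∀ x : A, rTensor A S (d (N x)) + lTensor A (N ∘ₗ N) (d x)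
      = TensorProduct.map S N (d x) + lTensor A N (d (N x)))

/-- The map `r♯ : A* → A`, `r♯(f) = Σ f(aᵢ) bᵢ`. -/
def rsharp (r : A ⊗[K] A) (f : A →ₗ[K] K) : A :=
  TensorProduct.lift (LinearMap.lsmul K A ∘ₗ f) r

/-- The map `N : A → A`, `N(x) = Σ ω(x, aᵢ) bᵢ`. -/
def hessNij (ω : A →ₗ[K] A →ₗ[K] K) (r : A ⊗[K] A) : A →ₗ[K] A :=
  TensorProduct.lift (LinearMap.smulRightₗ ∘ₗ ω.flip) r

/-- The map `S : A → A`, `S(x) = Σ aᵢ ω(bᵢ, x)`. -/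
def coNij (ω : A →ₗ[K] A →ₗ[K] K) (r : A ⊗[K] A) : A →ₗ[K] A :=
  TensorProduct.lift ((LinearMap.smulRightₗ ∘ₗ ω).flip) r

end Defs

section Rep

variable {K A V H : Type*} [Field K] [AddCommGroup A] [Module K A]
  [AddCommGroup V] [Module K V] [AddCommGroup H] [Module K H]

/-- `(V, ρ, φ)` is a representation of the pre-Lie algebra `(A, m)`. -/
def IsRep (m : A →ₗ[K] A →ₗ[K] A) (ρ φ : A →ₗ[K] V →ₗ[K] V) : Prop :=
  (∀ (x y : A) (v : V), ρ (m x y - m y x) v = ρ x (ρ y v) - ρ y (ρ x v)) ∧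
  (∀ (x y : A) (v : V), φ (m x y) v = ρ x (φ y v) - φ y (ρ x v) + φ y (φ x v))

/-- The `α`-conditions making `((V, ρ, φ), α)` a representation of `((A, m), N)`. -/
def IsNijRep (m : A →ₗ[K] A →ₗ[K] A) (N : A →ₗ[K] A) (ρ φ : A →ₗ[K] V →ₗ[K] V)
    (α : V →ₗ[K] V) : Prop :=
  (∀ (x : A) (v : V), ρ (N x) (α v) + α (α (ρ x v)) = α (ρ (N x) v) + α (ρ x (α v))) ∧
  (∀ (x : A) (v : V), φ (N x) (α v) + α (α (φ x v)) = α (φ (N x) v) + α (φ x (α v)))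

/-- The semidirect product multiplication on `A ⊕ V`:
`(x+u) ∘ (y+v) = x∘y + ρ(x)v + φ(y)u`. -/
def semidirectMul (m : A →ₗ[K] A →ₗ[K] A) (ρ φ : A →ₗ[K] V →ₗ[K] V) :
    (A × V) →ₗ[K] (A × V) →ₗ[K] (A × V) :=
  (m.compl₁₂ (fst K A V) (fst K A V)).compr₂ (inl K A V)
  + (ρ.compl₁₂ (fst K A V) (snd K A V)).compr₂ (inr K A V)
  + ((φ.compl₁₂ (fst K A V) (snd K A V)).compr₂ (inr K A V)).flip

/-- The bicrossed product multiplication on `A ⊕ H`: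
`(x+a) ∘ (y+b) = x∘y + ρ_H(a)y + φ_H(b)x + a∘b + ρ_A(x)b + φ_A(y)a`. -/
def matchedMul (mA : A →ₗ[K] A →ₗ[K] A) (mH : H →ₗ[K] H →ₗ[K] H)
    (ρA φA : A →ₗ[K] H →ₗ[K] H) (ρH φH : H →ₗ[K] A →ₗ[K] A) :
    (A × H) →ₗ[K] (A × H) →ₗ[K] (A × H) :=
  (mA.compl₁₂ (fst K A H) (fst K A H)).compr₂ (inl K A H)
  + (ρH.compl₁₂ (snd K A H) (fst K A H)).compr₂ (inl K A H)
  + ((φH.compl₁₂ (snd K A H) (fst K A H)).compr₂ (inl K A H)).flip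
  + (mH.compl₁₂ (snd K A H) (snd K A H)).compr₂ (inr K A H)
  + (ρA.compl₁₂ (fst K A H) (snd K A H)).compr₂ (inr K A H)
  + ((φA.compl₁₂ (fst K A H) (snd K A H)).compr₂ (inr K A H)).flip

/-- Equations (3.5)–(3.8) of a matched pair of pre-Lie algebras. -/
def MatchedPairEqs (mA : A →ₗ[K] A →ₗ[K] A) (mH : H →ₗ[K] H →ₗ[K] H)
    (ρA φA : A →ₗ[K] H →ₗ[K] H) (ρH φH : H →ₗ[K] A →ₗ[K] A) : Prop :=
  (∀ (x : A) (a b : H), ρA x (mH a b)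
      = -(ρA (ρH a x - φH a x) b) + mH (ρA x a - φA x a) b + φA (φH b x) a + mH a (ρA x b)) ∧
  (∀ (x : A) (a b : H), φA x (mH a b - mH b a)
      = φA (ρH b x) a - φA (ρH a x) b + mH a (φA x b) - mH b (φA x a)) ∧
  (∀ (a : H) (x y : A), ρH a (mA x y)
      = -(ρH (ρA x a - φA x a) y) + mA (ρH a x - φH a x) y + φH (φA y a) x + mA x (ρH a y)) ∧
  (∀ (a : H) (x y : A), φH a (mA x y - mA y x)
      = φH (ρA y a) x - φH (ρA x a) y + mA x (φH a y) - mA y (φH a x))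

/-- The (negative) dual action `x ↦ ρ*(x)`, `⟨ρ*(x)v*, v⟩ = −⟨v*, ρ(x)v⟩`. -/
def negTranspose (ρ : A →ₗ[K] V →ₗ[K] V) :
    A →ₗ[K] (V →ₗ[K] K) →ₗ[K] (V →ₗ[K] K) :=
  Module.Dual.transpose (R := K) ∘ₗ (-ρ)

end Rep

set_option synthInstance.maxHeartbeats 1000000
set_option maxHeartbeats 1000000

section Theorems

variable {K A V H : Type*} [Field K] [AddCommGroup A] [Module K A]
  [AddCommGroup V] [Module K V] [AddCommGroup H] [Module K H]

theorem semidirect_nijenhuis_iff_rep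
    (m : A →ₗ[K] A →ₗ[K] A) (N : A →ₗ[K] A)
    (hm : IsPreLie m) (hN : IsNijenhuis m N)
    (ρ φ : A →ₗ[K] V →ₗ[K] V) (hrep : IsRep m ρ φ) (α : V →ₗ[K] V) :
    (IsPreLie (semidirectMul m ρ φ) ∧
        IsNijenhuis (semidirectMul m ρ φ) (N.prodMap α)) ↔
      (IsRep m ρ φ ∧ IsNijRep m N ρ φ α) := by
  have hs : ∀ p q : A × V, semidirectMul m ρ φ p q
      = (m p.1 q.1, ρ p.1 q.2 + φ q.1 p.2) := by
    intro p q
    ext <;> simp [semidirectMul]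
  constructor
  · rintro ⟨-, h⟩
    refine ⟨hrep, fun x v => ?_, fun x v => ?_⟩
    · have := congrArg Prod.snd (h (x, 0) (0, v))
      simpa [hs] using this
    · have := congrArg Prod.snd (h (0, v) (x, 0))
      simp [hs] at this
      rw [this, add_comm]
  · rintro ⟨⟨h1, h2⟩, h3, h4⟩
    refine ⟨?_, ?_⟩
    · rintro ⟨x, u⟩ ⟨y, v⟩ ⟨z, w⟩
      have e1 := h1 x y w
      have e2 := h2 y z u
      have e3 := h2 x z v
      simp only [map_sub, LinearMap.sub_apply] at e1
      ext
      · simpa [hs] using hm x y z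
      · simp only [hs, Prod.snd_sub, map_add]
        rw [e2, e3, sub_eq_iff_eq_add.mp e1]
        abel
    · rintro ⟨x, u⟩ ⟨y, v⟩
      have e3 := h3 x v
      have e4 := h4 y u
      ext
      · simpa [hs] using hN x y
      · simp only [hs, Prod.snd_add, LinearMap.prodMap_apply, map_add]
        calc _ = (ρ (N x) (α v) + α (α (ρ x v))) + (φ (N y) (α u) + α (α (φ y u))) := by abel
          _ = _ := by rw [e3, e4]; abel

end Theorems
end
end

section
/- Let ((A, ∘_A), N_A) and ((h, ∘_h), N_h) be Nijenhuis pre-Lie algebras over a field K, let ((h, ρ_A, φ_A), N_h) be a representation of ((A, ∘_A), N_A) and ((A, ρ_h, φ_h), N_A) be a representation of ((h, ∘_h), N_h). Define on A⊕h the product (x+a) ∘_⋆ (y+b) := x∘_A y + ρ_h(a)y + φ_h(b)x + a∘_h b + ρ_A(x)b + φ_A(y)a, and the map N_⋆(x+a) := N_A(x) + N_h(a). Then ((A⊕h, ∘_⋆), N_⋆) is a Nijenhuis pre-Lie algebra if and only if for all x, y ∈ A and a, b ∈ h: (i) ρ_A(x)(a∘_h b) = −ρ_A(ρ_h(a)x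 − φ_h(a)x)b + (ρ_A(x)a − φ_A(x)a)∘_h b + φ_A(φ_h(b)x)a + a∘_h(ρ_A(x)b); (ii) φ_A(x)(a∘_h b − b∘_h a) = φ_A(ρ_h(b)x)a − φ_A(ρ_h(a)x)b + a∘_h(φ_A(x)b) − b∘_h(φ_A(x)a); (iii) ρ_h(a)(x∘_A y) = −ρ_h(ρ_A(x)a − φ_A(x)a)y + (ρ_h(a)x − φ_h(a)x)∘_A y + φ_h(φ_A(y)a)x + x∘_A(ρ_h(a)y); (iv) φ_h(a)(x∘_A y − y∘_A x) = φ_h(ρ_A(y)a)x − φ_h(ρ_A(x)a)y + x∘_A(φ_h(a)y) − y∘_A(φ_h(a)x). -/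
open TensorProduct LinearMap

noncomputable section

set_option synthInstance.maxHeartbeats 1000000
set_option maxHeartbeats 1000000

section Theorems

variable {K A V H : Type*} [Field K] [AddCommGroup A] [Module K A]
  [AddCommGroup V] [Module K V] [AddCommGroup H] [Module K H]

theorem matched_pair_iff_nijenhuis
    (mA : A →ₗ[K] A →ₗ[K] A) (NA : A →ₗ[K] A)
    (mH : H →ₗ[K] H →ₗ[K] H) (NH : H →ₗ[K] H)
    (hA : IsPreLie mA) (hNA : IsNijenhuis mA NA)
    (hH : IsPreLie mH) (hNH : IsNijenhuis mH NH)
    (ρA φA : A →ₗ[K] H →ₗ[K] H) (ρH φH : H →ₗ[K] A →ₗ[K] A)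
    (hrepA : IsRep mA ρA φA) (hNrepA : IsNijRep mA NA ρA φA NH)
    (hrepH : IsRep mH ρH φH) (hNrepH : IsNijRep mH NH ρH φH NA) :
    (IsPreLie (matchedMul mA mH ρA φA ρH φH) ∧
        IsNijenhuis (matchedMul mA mH ρA φA ρH φH) (NA.prodMap NH)) ↔
      MatchedPairEqs mA mH ρA φA ρH φH := by
  have hm : ∀ (x y : A) (a b : H), matchedMul mA mH ρA φA ρH φH (x, a) (y, b)
      = (mA x y + ρH a y + φH b x, mH a b + ρA x b + φA y a) := by
    intro x y a b
    simp [matchedMul]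
  obtain ⟨rA1, rA2⟩ := hrepA
  obtain ⟨rH1, rH2⟩ := hrepH
  obtain ⟨nA1, nA2⟩ := hNrepA
  obtain ⟨nH1, nH2⟩ := hNrepH
  unfold IsPreLie at hA hH
  unfold IsNijenhuis at hNA hNH
  constructor
  · rintro ⟨h, -⟩
    refine ⟨?_, ?_, ?_, ?_⟩
    · intro x a b
      have := congrArg Prod.snd (h (x, 0) (0, a) (0, b))
      simp only [hm, Prod.snd_sub, map_zero, LinearMap.zero_apply, add_zero, zero_add] at this
      simp only [map_sub, LinearMap.sub_apply]
      linear_combination (norm := module) -this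
    · intro x a b
      have := congrArg Prod.snd (h (0, a) (0, b) (x, 0))
      simp only [hm, Prod.snd_sub, map_zero, LinearMap.zero_apply, add_zero, zero_add] at this
      simp only [map_sub]
      linear_combination (norm := module) this
    · intro a x y
      have := congrArg Prod.fst (h (0, a) (x, 0) (y, 0))
      simp only [hm, Prod.fst_sub, map_zero, LinearMap.zero_apply, add_zero, zero_add] at this
      simp only [map_sub, LinearMap.sub_apply]
      linear_combination (norm := module) -this
    · intro a x y
      have := congrArg Prod.fst (h (x, 0) (y, 0) (0, a))
      simp only [hm, Prod.fst_sub, map_zero, LinearMap.zero_apply, add_zero, zero_add] at this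
      simp only [map_sub]
      linear_combination (norm := module) this
  · rintro ⟨h1, h2, h3, h4⟩
    simp only [map_sub, LinearMap.sub_apply] at h1 h2 h3 h4 rA1 rH1
    constructor
    · rintro ⟨x, a⟩ ⟨y, b⟩ ⟨z, c⟩
      simp only [hm, Prod.mk_sub_mk, map_add, LinearMap.add_apply, Prod.mk.injEq]
      constructor
      · linear_combination (norm := module) hA x y z + rH1 a b z - rH2 b c x + rH2 a c y
          + h3 b x z - h3 a y z + h4 c x y
      · linear_combination (norm := module) hH a b c + rA1 x y c - rA2 y z a + rA2 x z b
          + h1 y a c - h1 x b c + h2 z a b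
    · rintro ⟨x, a⟩ ⟨y, b⟩
      simp only [hm, LinearMap.prodMap_apply, Prod.mk_add_mk, map_add, Prod.mk.injEq]
      constructor
      · linear_combination (norm := module) hNA x y + nH1 a y + nH2 b x
      · linear_combination (norm := module) hNH a b + nA1 x b + nA2 y a

end Theorems
end
end

section
/- Let ((A, ∘), N) be an S-admissible Nijenhuis pre-Lie algebra over a field K (S : A → A linear), and let r = Σᵢ aᵢ⊗bᵢ ∈ A⊗A be a symmetric solution of the S-equation in (A, ∘) such that (S⊗id)(r) = (id⊗N)(r). Then, with Δ_r(x) = Σᵢ (x∘aᵢ⊗bᵢ + aᵢ⊗x∘bᵢ − aᵢ⊗bᵢ∘x), the quintuple (A, ∘, Δ_r, N, S) is a Nijenhuis pre-Lie bialgebra. -/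
open TensorProduct LinearMap

noncomputable section

set_option synthInstance.maxHeartbeats 1000000
set_option maxHeartbeats 1000000

section Theorems

variable {K A V H : Type*} [Field K] [AddCommGroup A] [Module K A]
  [AddCommGroup V] [Module K V] [AddCommGroup H] [Module K H]


lemma bil_transfer {M : Type*} [AddCommGroup M] [Module K M] {ι : Type*} (s : Finset ι)
    (u v u' v' : ι → A)
    (h : ∑ p ∈ s, u p ⊗ₜ[K] v p = ∑ p ∈ s, u' p ⊗ₜ[K] v' p)
    (f : A → A → M)
    (h1 : ∀ a a' b, f (a + a') b = f a b + f a' b)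
    (h2 : ∀ (c : K) a b, f (c • a) b = c • f a b)
    (h3 : ∀ a b b', f a (b + b') = f a b + f a b')
    (h4 : ∀ (c : K) a b, f a (c • b) = c • f a b) :
    ∑ p ∈ s, f (u p) (v p) = ∑ p ∈ s, f (u' p) (v' p) := by
  have := congrArg (TensorProduct.lift (LinearMap.mk₂ K f h1 h2 h3 h4)) h
  simpa using this

lemma coprodR_sum (m : A →ₗ[K] A →ₗ[K] A) (s : Finset (A × A)) (x : A) :
    coprodR m (∑ p ∈ s, p.1 ⊗ₜ[K] p.2) x
      = ∑ p ∈ s, m x p.1 ⊗ₜ[K] p.2 + ∑ p ∈ s, p.1 ⊗ₜ[K] m x p.2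
        - ∑ p ∈ s, p.1 ⊗ₜ[K] m p.2 x := by
  simp [coprodR]

lemma swap12_tmul (a b c : A) : swap12 K A (a ⊗ₜ[K] (b ⊗ₜ[K] c)) = b ⊗ₜ[K] (a ⊗ₜ[K] c) := by
  simp [swap12, flipT]

lemma qt_bialg1 (m : A →ₗ[K] A →ₗ[K] A) (hm : IsPreLie m) (s : Finset (A × A)) :
    BialgEq1 m (coprodR m (∑ p ∈ s, p.1 ⊗ₜ[K] p.2)) := by
  intro x y
  simp only [coprodR_sum, map_add, map_sub, map_sum, rTensor_tmul, lTensor_tmul,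
    LinearMap.flip_apply]
  simp only [← Finset.sum_add_distrib, ← Finset.sum_sub_distrib]
  refine Finset.sum_congr rfl fun p _ => ?_
  obtain ⟨a, b⟩ := p
  have e1 : m (m x y) a = m (m y x) a - m y (m x a) + m x (m y a) := by
    rw [← hm x y a]; abel
  have e2 : m (m x y) b = m (m y x) b - m y (m x b) + m x (m y b) := by
    rw [← hm x y b]; abel
  have e3 : m b (m x y) = m (m b x) y - m (m x b) y + m x (m b y) := by
    have := hm b x y
    linear_combination (norm := module) -this
  have e4 : m b (m y x) = m (m b y) x - m (m y b) x + m y (m b x) := by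
    have := hm b y x
    linear_combination (norm := module) -this
  simp only [e1, e2, e3, e4, add_tmul, sub_tmul, tmul_add, tmul_sub]
  abel

lemma qt_bialg2 (m : A →ₗ[K] A →ₗ[K] A) (hm : IsPreLie m) (s : Finset (A × A))
    (hr : ∑ p ∈ s, p.1 ⊗ₜ[K] p.2 = ∑ p ∈ s, p.2 ⊗ₜ[K] p.1) :
    BialgEq2 m (coprodR m (∑ p ∈ s, p.1 ⊗ₜ[K] p.2)) := by
  intro x y
  have key : ∀ u v : A →ₗ[K] A, ∑ p ∈ s, u p.1 ⊗ₜ[K] v p.2 = ∑ p ∈ s, u p.2 ⊗ₜ[K] v p.1 := by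
    intro u v
    exact bil_transfer s _ _ _ _ hr (fun a b => u a ⊗ₜ[K] v b)
      (by simp [add_tmul]) (by simp [← smul_tmul']) (by simp [tmul_add]) (by simp)
  have s1 := key (m (m x y)) LinearMap.id
  have s2 := key LinearMap.id (m (m x y))
  have s3 := key (m x) (m y)
  have s4 := key (m y) (m x)
  have s5 := key (m x ∘ₗ m y) LinearMap.id
  have s6 := key LinearMap.id (m x ∘ₗ m y)
  simp only [LinearMap.id_apply, LinearMap.comp_apply] at s1 s2 s3 s4 s5 s6
  have e3 : ∀ b, m b (m x y) = m (m b x) y - m (m x b) y + m x (m b y) := by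
    intro b
    have := hm b x y
    linear_combination (norm := module) -this
  simp only [coprodR_sum, map_add, map_sub, map_sum, rTensor_tmul, lTensor_tmul,
    LinearMap.flip_apply, flipT, LinearEquiv.coe_coe, TensorProduct.comm_tmul, e3, tmul_add,
    tmul_sub, add_tmul, sub_tmul, Finset.sum_add_distrib, Finset.sum_sub_distrib]
  linear_combination (norm := module) s1 + s2 - s3 - s4 - s5 - s6

section Nij
variable (m : A →ₗ[K] A →ₗ[K] A) (N S : A →ₗ[K] A) (s : Finset (A × A))

lemma qt_nij (hN : IsNijenhuis m N) (hAdm : IsAdmissible m N S)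
    (hr : ∑ p ∈ s, p.1 ⊗ₜ[K] p.2 = ∑ p ∈ s, p.2 ⊗ₜ[K] p.1)
    (hc : ∑ p ∈ s, S p.1 ⊗ₜ[K] p.2 = ∑ p ∈ s, p.1 ⊗ₜ[K] N p.2) :
    IsNijenhuisCo (coprodR m (∑ p ∈ s, p.1 ⊗ₜ[K] p.2)) S ∧
    IsCoAdmissible (coprodR m (∑ p ∈ s, p.1 ⊗ₜ[K] p.2)) N S := by
  obtain ⟨A1, A2⟩ := hAdm
  have hc' : ∑ p ∈ s, N p.1 ⊗ₜ[K] p.2 = ∑ p ∈ s, p.1 ⊗ₜ[K] S p.2 := by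
    have t1 := bil_transfer s _ _ _ _ hr (fun a b => N a ⊗ₜ[K] b)
      (by simp [add_tmul]) (by simp [← smul_tmul']) (by simp [tmul_add]) (by simp)
    have t2 := bil_transfer s _ _ _ _ hr (fun a b => a ⊗ₜ[K] S b)
      (by simp [add_tmul]) (by simp [← smul_tmul']) (by simp [tmul_add]) (by simp)
    have t3 := bil_transfer s _ _ _ _ hc (fun a b => b ⊗ₜ[K] a)
      (by simp [tmul_add]) (by simp) (by simp [add_tmul]) (by simp [← smul_tmul'])
    rw [t1, t2, t3]
  -- move `S` on the left leg to `N` on the right leg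
  have k1 : ∀ u v : A →ₗ[K] A, ∑ p ∈ s, u (S p.1) ⊗ₜ[K] v p.2
      = ∑ p ∈ s, u p.1 ⊗ₜ[K] v (N p.2) := by
    intro u v
    exact bil_transfer s _ _ _ _ hc (fun a b => u a ⊗ₜ[K] v b)
      (by simp [add_tmul]) (by simp [← smul_tmul']) (by simp [tmul_add]) (by simp)
  have k2 : ∀ u v : A →ₗ[K] A, ∑ p ∈ s, u (N p.1) ⊗ₜ[K] v p.2
      = ∑ p ∈ s, u p.1 ⊗ₜ[K] v (S p.2) := by
    intro u v
    exact bil_transfer s _ _ _ _ hc' (fun a b => u a ⊗ₜ[K] v b)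
      (by simp [add_tmul]) (by simp [← smul_tmul']) (by simp [tmul_add]) (by simp)
  have left : ∀ f g h k : A → A, (∀ a, f a + g a = h a + k a) →
      ∑ p ∈ s, f p.1 ⊗ₜ[K] p.2 + ∑ p ∈ s, g p.1 ⊗ₜ[K] p.2
        = ∑ p ∈ s, h p.1 ⊗ₜ[K] p.2 + ∑ p ∈ s, k p.1 ⊗ₜ[K] p.2 := by
    intro f g h k H
    simp only [← Finset.sum_add_distrib, ← add_tmul, H]
  have right : ∀ f g h k : A → A, (∀ a, f a + g a = h a + k a) →
      ∑ p ∈ s, p.1 ⊗ₜ[K] f p.2 + ∑ p ∈ s, p.1 ⊗ₜ[K] g p.2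
        = ∑ p ∈ s, p.1 ⊗ₜ[K] h p.2 + ∑ p ∈ s, p.1 ⊗ₜ[K] k p.2 := by
    intro f g h k H
    simp only [← Finset.sum_add_distrib, ← tmul_add, H]
  refine ⟨fun x => ?_, fun x => ?_, fun x => ?_⟩
  · have f1 := left _ _ _ _ (fun a => A2 x a)
    have f2 := right _ _ _ _ (fun a => A2 x a)
    have f3 := right _ _ _ _ (fun a => A1 a x)
    have g1 := k2 (S ∘ₗ m x) LinearMap.id
    have g2 := k1 LinearMap.id (S ∘ₗ m x)
    have g3 := k1 LinearMap.id (S ∘ₗ m.flip x)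
    have g4 := k1 LinearMap.id (m (S x))
    have g5 := k1 LinearMap.id (m.flip (S x))
    have g6 := k2 (m (S x)) LinearMap.id
    simp only [LinearMap.id_apply, LinearMap.comp_apply, LinearMap.flip_apply]
      at g1 g2 g3 g4 g5 g6
    simp only [coprodR_sum, map_add, map_sub, map_sum, rTensor_tmul, lTensor_tmul,
      TensorProduct.map_tmul]
    linear_combination (norm := module) f1 + f2 - f3 - g1 + g2 - g3 - g4 + g5 + g6
  · have f1 := left _ _ _ _ (fun a => hN x a)
    have f2 := right _ _ _ _ (fun a => A1 x a)
    have f3 := right _ _ _ _ (fun a => A2 a x)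
    have g1 := k2 (m (N x)) LinearMap.id
    have g2 := k2 N (m x)
    have g2' := k2 LinearMap.id (m x ∘ₗ S)
    have g3 := k2 N (m.flip x)
    have g3' := k2 LinearMap.id (m.flip x ∘ₗ S)
    have g4 := k2 (N ∘ₗ m x) LinearMap.id
    have g5 := k2 LinearMap.id (S ∘ₗ m x)
    have g6 := k2 LinearMap.id (S ∘ₗ m.flip x)
    have g7 := k2 LinearMap.id (m (N x))
    have g8 := k2 LinearMap.id (m.flip (N x))
    simp only [LinearMap.id_apply, LinearMap.comp_apply, LinearMap.flip_apply]
      at g1 g2 g2' g3 g3' g4 g5 g6 g7 g8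
    simp only [coprodR_sum, map_add, map_sub, map_sum, rTensor_tmul, lTensor_tmul,
      TensorProduct.map_tmul, LinearMap.comp_apply]
    linear_combination (norm := module) f1 + f2 - f3 - g1 + g2 + g2' - g3 - g3' + g4 - g5 + g6 - g7 + g8
  · have f1 := left _ _ _ _ (fun a => A1 x a)
    have f2 := right _ _ _ _ (fun a => hN x a)
    have f3 := right _ _ _ _ (fun a => hN a x)
    have g1 := k1 (m x) N
    have g2 := k1 (m x ∘ₗ S) LinearMap.id
    have g3 := k1 LinearMap.id (m (N x))
    have g4 := k1 LinearMap.id (m.flip (N x))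
    have g5 := k1 (S ∘ₗ m x) LinearMap.id
    have g6 := k1 LinearMap.id (N ∘ₗ m x)
    have g7 := k1 LinearMap.id (N ∘ₗ m.flip x)
    have g8 := k1 (m (N x)) LinearMap.id
    simp only [LinearMap.id_apply, LinearMap.comp_apply, LinearMap.flip_apply]
      at g1 g2 g3 g4 g5 g6 g7 g8
    simp only [coprodR_sum, map_add, map_sub, map_sum, rTensor_tmul, lTensor_tmul,
      TensorProduct.map_tmul, LinearMap.comp_apply]
    linear_combination (norm := module) f1 + f2 - f3 - g1 - g2 + g3 - g4 + g5 - g6 + g7 + g8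

end Nij


lemma flipL {M : Type*} [AddCommGroup M] [Module K M] (s : Finset (A × A))
    (hr : ∑ p ∈ s, p.1 ⊗ₜ[K] p.2 = ∑ p ∈ s, p.2 ⊗ₜ[K] p.1)
    (F : A → A → A → A → M)
    (h1 : ∀ a a' b c d, F (a + a') b c d = F a b c d + F a' b c d)
    (h2 : ∀ (k : K) a b c d, F (k • a) b c d = k • F a b c d)
    (h3 : ∀ a b b' c d, F a (b + b') c d = F a b c d + F a b' c d)
    (h4 : ∀ (k : K) a b c d, F a (k • b) c d = k • F a b c d) :
    ∑ p ∈ s, ∑ q ∈ s, F p.1 p.2 q.1 q.2 = ∑ p ∈ s, ∑ q ∈ s, F p.2 p.1 q.1 q.2 :=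
  bil_transfer s _ _ _ _ hr (fun a b => ∑ q ∈ s, F a b q.1 q.2)
    (by simp [h1, Finset.sum_add_distrib]) (by simp [h2, Finset.smul_sum])
    (by simp [h3, Finset.sum_add_distrib]) (by simp [h4, Finset.smul_sum])

lemma flipR {M : Type*} [AddCommGroup M] [Module K M] (s : Finset (A × A))
    (hr : ∑ p ∈ s, p.1 ⊗ₜ[K] p.2 = ∑ p ∈ s, p.2 ⊗ₜ[K] p.1)
    (F : A → A → A → A → M)
    (h1 : ∀ a b c c' d, F a b (c + c') d = F a b c d + F a b c' d)
    (h2 : ∀ (k : K) a b c d, F a b (k • c) d = k • F a b c d)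
    (h3 : ∀ a b c d d', F a b c (d + d') = F a b c d + F a b c d')
    (h4 : ∀ (k : K) a b c d, F a b c (k • d) = k • F a b c d) :
    ∑ p ∈ s, ∑ q ∈ s, F p.1 p.2 q.1 q.2 = ∑ p ∈ s, ∑ q ∈ s, F p.1 p.2 q.2 q.1 :=
  Finset.sum_congr rfl fun p _ =>
    bil_transfer s _ _ _ _ hr (fun c d => F p.1 p.2 c d)
      (h1 _ _) (fun k => h2 k _ _) (h3 _ _) (fun k => h4 k _ _)

/-- `S`-equation in canonical form. -/
lemma seq_canon (m : A →ₗ[K] A →ₗ[K] A) (s : Finset (A × A))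
    (hr : ∑ p ∈ s, p.1 ⊗ₜ[K] p.2 = ∑ p ∈ s, p.2 ⊗ₜ[K] p.1)
    (hS : IsSEq m (∑ p ∈ s, p.1 ⊗ₜ[K] p.2)) :
    ∑ p ∈ s, ∑ q ∈ s, p.1 ⊗ₜ[K] (m p.2 q.2 ⊗ₜ[K] q.1)
      + ∑ p ∈ s, ∑ q ∈ s, p.1 ⊗ₜ[K] (q.1 ⊗ₜ[K] m p.2 q.2)
      = ∑ p ∈ s, ∑ q ∈ s, m p.2 q.2 ⊗ₜ[K] (p.1 ⊗ₜ[K] q.1)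
      + ∑ p ∈ s, ∑ q ∈ s, p.1 ⊗ₜ[K] (q.1 ⊗ₜ[K] m q.2 p.2) := by
  have e : (∑ p ∈ s, p.1 ⊗ₜ[K] p.2) ⊗ₜ[K] (∑ p ∈ s, p.1 ⊗ₜ[K] p.2)
      = ∑ p ∈ s, ∑ q ∈ s, (p.1 ⊗ₜ[K] p.2) ⊗ₜ[K] (q.1 ⊗ₜ[K] q.2) := by
    rw [sum_tmul]
    exact Finset.sum_congr rfl fun p _ => tmul_sum _ _ _
  have f1 := flipR s hr (fun a b c d => a ⊗ₜ[K] (m b c ⊗ₜ[K] d))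
    (by simp [add_tmul, tmul_add]) (by simp [← smul_tmul']) (by simp [tmul_add]) (by simp)
  have f2 := flipL s hr (fun a b c d => m a c ⊗ₜ[K] (b ⊗ₜ[K] d))
    (by simp [add_tmul]) (by simp [← smul_tmul'])
    (by simp [add_tmul, tmul_add]) (by simp [← smul_tmul'])
  have f3 := flipR s hr (fun a b c d => m b c ⊗ₜ[K] (a ⊗ₜ[K] d))
    (by simp [add_tmul]) (by simp [← smul_tmul']) (by simp [tmul_add]) (by simp)
  unfold IsSEq at hS
  rw [e] at hS
  simp only [map_sum, sTerm1, sTerm2, sTerm3, sTerm4, mhat, ttc, LinearMap.comp_apply,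
    LinearEquiv.coe_coe, TensorProduct.assoc_tmul, TensorProduct.assoc_symm_tmul, lTensor_tmul,
    rTensor_tmul, swap12_tmul, TensorProduct.lift.tmul, flipT, TensorProduct.comm_tmul,
    TensorProduct.tensorTensorTensorComm_tmul] at hS
  linear_combination (norm := module) hS - f1 + f2 + f3

lemma coassoc1_canon (m : A →ₗ[K] A →ₗ[K] A) (s : Finset (A × A))
    (hr : ∑ p ∈ s, p.1 ⊗ₜ[K] p.2 = ∑ p ∈ s, p.2 ⊗ₜ[K] p.1) (x : A) :
    coassoc1 (coprodR m (∑ p ∈ s, p.1 ⊗ₜ[K] p.2)) (coprodR m (∑ p ∈ s, p.1 ⊗ₜ[K] p.2)) x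
      = ∑ p ∈ s, ∑ q ∈ s, m (m x q.2) p.2 ⊗ₜ[K] (p.1 ⊗ₜ[K] q.1)
      + ∑ p ∈ s, ∑ q ∈ s, p.1 ⊗ₜ[K] (m (m x q.2) p.2 ⊗ₜ[K] q.1)
      - ∑ p ∈ s, ∑ q ∈ s, p.1 ⊗ₜ[K] (m p.2 (m x q.2) ⊗ₜ[K] q.1)
      + ∑ p ∈ s, ∑ q ∈ s, m q.2 p.2 ⊗ₜ[K] (p.1 ⊗ₜ[K] m x q.1)
      - ∑ p ∈ s, ∑ q ∈ s, m q.2 p.2 ⊗ₜ[K] (p.1 ⊗ₜ[K] m q.1 x)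
      + ∑ p ∈ s, ∑ q ∈ s, p.1 ⊗ₜ[K] (m q.2 p.2 ⊗ₜ[K] m x q.1)
      - ∑ p ∈ s, ∑ q ∈ s, p.1 ⊗ₜ[K] (m p.2 q.2 ⊗ₜ[K] m x q.1)
      - ∑ p ∈ s, ∑ q ∈ s, p.1 ⊗ₜ[K] (m q.2 p.2 ⊗ₜ[K] m q.1 x)
      + ∑ p ∈ s, ∑ q ∈ s, p.1 ⊗ₜ[K] (m p.2 q.2 ⊗ₜ[K] m q.1 x) := by
  -- `G a b c d`: outer pair `(a, b)`, inner pair `(c, d)`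
  have sw : ∀ G : A → A → A → A → A ⊗[K] (A ⊗[K] A),
      ∑ p ∈ s, ∑ q ∈ s, G p.1 p.2 q.1 q.2 = ∑ p ∈ s, ∑ q ∈ s, G q.1 q.2 p.1 p.2 :=
    fun G => Finset.sum_comm
  have raw : coassoc1 (coprodR m (∑ p ∈ s, p.1 ⊗ₜ[K] p.2))
        (coprodR m (∑ p ∈ s, p.1 ⊗ₜ[K] p.2)) x
      = ∑ p ∈ s, ∑ q ∈ s, m (m x p.1) q.1 ⊗ₜ[K] (q.2 ⊗ₜ[K] p.2)
      + ∑ p ∈ s, ∑ q ∈ s, q.1 ⊗ₜ[K] (m (m x p.1) q.2 ⊗ₜ[K] p.2)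
      - ∑ p ∈ s, ∑ q ∈ s, q.1 ⊗ₜ[K] (m q.2 (m x p.1) ⊗ₜ[K] p.2)
      + ∑ p ∈ s, ∑ q ∈ s, m p.1 q.1 ⊗ₜ[K] (q.2 ⊗ₜ[K] m x p.2)
      - ∑ p ∈ s, ∑ q ∈ s, m p.1 q.1 ⊗ₜ[K] (q.2 ⊗ₜ[K] m p.2 x)
      + ∑ p ∈ s, ∑ q ∈ s, q.1 ⊗ₜ[K] (m p.1 q.2 ⊗ₜ[K] m x p.2)
      - ∑ p ∈ s, ∑ q ∈ s, q.1 ⊗ₜ[K] (m q.2 p.1 ⊗ₜ[K] m x p.2)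
      - ∑ p ∈ s, ∑ q ∈ s, q.1 ⊗ₜ[K] (m p.1 q.2 ⊗ₜ[K] m p.2 x)
      + ∑ p ∈ s, ∑ q ∈ s, q.1 ⊗ₜ[K] (m q.2 p.1 ⊗ₜ[K] m p.2 x) := by
    simp only [coassoc1, LinearMap.comp_apply, coprodR_sum, map_add, map_sub, map_sum,
      TensorProduct.map_tmul, add_tmul, sub_tmul, sum_tmul, LinearMap.id_apply,
      LinearEquiv.coe_coe, TensorProduct.assoc_tmul, Finset.sum_add_distrib,
      Finset.sum_sub_distrib]
    abel
  have f1 := flipR s hr (fun a b c d => m (m x a) c ⊗ₜ[K] (d ⊗ₜ[K] b))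
    (by simp [add_tmul, tmul_add]) (by simp [← smul_tmul'])
    (by simp [add_tmul, tmul_add]) (by simp [← smul_tmul'])
  have f4 := flipR s hr (fun a b c d => m a c ⊗ₜ[K] (d ⊗ₜ[K] m x b))
    (by simp [add_tmul, tmul_add]) (by simp [← smul_tmul'])
    (by simp [add_tmul, tmul_add]) (by simp [← smul_tmul'])
  have f5 := flipR s hr (fun a b c d => m a c ⊗ₜ[K] (d ⊗ₜ[K] m b x))
    (by simp [add_tmul, tmul_add]) (by simp [← smul_tmul'])
    (by simp [add_tmul, tmul_add]) (by simp [← smul_tmul'])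
  have fl : ∀ F : A → A → A → A → A ⊗[K] (A ⊗[K] A),
    (∀ a a' b c d, F (a + a') b c d = F a b c d + F a' b c d) →
    (∀ (k : K) a b c d, F (k • a) b c d = k • F a b c d) →
    (∀ a b b' c d, F a (b + b') c d = F a b c d + F a b' c d) →
    (∀ (k : K) a b c d, F a (k • b) c d = k • F a b c d) →
    ∑ p ∈ s, ∑ q ∈ s, F p.1 p.2 q.1 q.2 = ∑ p ∈ s, ∑ q ∈ s, F q.2 q.1 p.1 p.2 := by
    intro F h1 h2 h3 h4
    rw [flipL s hr F h1 h2 h3 h4]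
    exact Finset.sum_comm
  have g1 := fl (fun a b c d => m (m x a) d ⊗ₜ[K] (c ⊗ₜ[K] b))
    (by simp [add_tmul, tmul_add]) (by simp [← smul_tmul'])
    (by simp [add_tmul, tmul_add]) (by simp [← smul_tmul'])
  have g2 := fl (fun a b c d => c ⊗ₜ[K] (m (m x a) d ⊗ₜ[K] b))
    (by simp [add_tmul, tmul_add]) (by simp [← smul_tmul'])
    (by simp [add_tmul, tmul_add]) (by simp [← smul_tmul'])
  have g3 := fl (fun a b c d => c ⊗ₜ[K] (m d (m x a) ⊗ₜ[K] b))
    (by simp [add_tmul, tmul_add]) (by simp [← smul_tmul'])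
    (by simp [add_tmul, tmul_add]) (by simp [← smul_tmul'])
  have g4 := fl (fun a b c d => m a d ⊗ₜ[K] (c ⊗ₜ[K] m x b))
    (by simp [add_tmul, tmul_add]) (by simp [← smul_tmul'])
    (by simp [add_tmul, tmul_add]) (by simp [← smul_tmul'])
  have g5 := fl (fun a b c d => m a d ⊗ₜ[K] (c ⊗ₜ[K] m b x))
    (by simp [add_tmul, tmul_add]) (by simp [← smul_tmul'])
    (by simp [add_tmul, tmul_add]) (by simp [← smul_tmul'])
  have g6 := fl (fun a b c d => c ⊗ₜ[K] (m a d ⊗ₜ[K] m x b))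
    (by simp [add_tmul, tmul_add]) (by simp [← smul_tmul'])
    (by simp [add_tmul, tmul_add]) (by simp [← smul_tmul'])
  have g7 := fl (fun a b c d => c ⊗ₜ[K] (m d a ⊗ₜ[K] m x b))
    (by simp [add_tmul, tmul_add]) (by simp [← smul_tmul'])
    (by simp [add_tmul, tmul_add]) (by simp [← smul_tmul'])
  have g8 := fl (fun a b c d => c ⊗ₜ[K] (m a d ⊗ₜ[K] m b x))
    (by simp [add_tmul, tmul_add]) (by simp [← smul_tmul'])
    (by simp [add_tmul, tmul_add]) (by simp [← smul_tmul'])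
  have g9 := fl (fun a b c d => c ⊗ₜ[K] (m d a ⊗ₜ[K] m b x))
    (by simp [add_tmul, tmul_add]) (by simp [← smul_tmul'])
    (by simp [add_tmul, tmul_add]) (by simp [← smul_tmul'])
  rw [raw]
  linear_combination (norm := module) f1 + f4 - f5 + g1 + g2 - g3 + g4 - g5 + g6 - g7 - g8 + g9

lemma coassoc2_canon (m : A →ₗ[K] A →ₗ[K] A) (s : Finset (A × A))
    (hr : ∑ p ∈ s, p.1 ⊗ₜ[K] p.2 = ∑ p ∈ s, p.2 ⊗ₜ[K] p.1) (x : A) :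
    coassoc2 (coprodR m (∑ p ∈ s, p.1 ⊗ₜ[K] p.2)) (coprodR m (∑ p ∈ s, p.1 ⊗ₜ[K] p.2)) x
      = ∑ p ∈ s, ∑ q ∈ s, m x p.1 ⊗ₜ[K] (m p.2 q.2 ⊗ₜ[K] q.1)
      + ∑ p ∈ s, ∑ q ∈ s, m x p.1 ⊗ₜ[K] (q.1 ⊗ₜ[K] m p.2 q.2)
      - ∑ p ∈ s, ∑ q ∈ s, m x p.1 ⊗ₜ[K] (q.1 ⊗ₜ[K] m q.2 p.2)
      + ∑ p ∈ s, ∑ q ∈ s, p.1 ⊗ₜ[K] (m (m x p.2) q.2 ⊗ₜ[K] q.1)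
      - ∑ p ∈ s, ∑ q ∈ s, p.1 ⊗ₜ[K] (m (m p.2 x) q.2 ⊗ₜ[K] q.1)
      + ∑ p ∈ s, ∑ q ∈ s, p.1 ⊗ₜ[K] (q.1 ⊗ₜ[K] m (m x p.2) q.2)
      - ∑ p ∈ s, ∑ q ∈ s, p.1 ⊗ₜ[K] (q.1 ⊗ₜ[K] m (m p.2 x) q.2)
      - ∑ p ∈ s, ∑ q ∈ s, p.1 ⊗ₜ[K] (q.1 ⊗ₜ[K] m q.2 (m x p.2))
      + ∑ p ∈ s, ∑ q ∈ s, p.1 ⊗ₜ[K] (q.1 ⊗ₜ[K] m q.2 (m p.2 x)) := by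
  have f1 := flipR s hr (fun a b c d => m x a ⊗ₜ[K] (m b c ⊗ₜ[K] d))
    (by simp [add_tmul, tmul_add]) (by simp [← smul_tmul'])
    (by simp [add_tmul, tmul_add]) (by simp [← smul_tmul'])
  have f2 := flipR s hr (fun a b c d => a ⊗ₜ[K] (m (m x b) c ⊗ₜ[K] d))
    (by simp [add_tmul, tmul_add]) (by simp [← smul_tmul'])
    (by simp [add_tmul, tmul_add]) (by simp [← smul_tmul'])
  have f3 := flipR s hr (fun a b c d => a ⊗ₜ[K] (m (m b x) c ⊗ₜ[K] d))
    (by simp [add_tmul, tmul_add]) (by simp [← smul_tmul'])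
    (by simp [add_tmul, tmul_add]) (by simp [← smul_tmul'])
  simp only [coassoc2, LinearMap.comp_apply, coprodR_sum, map_add, map_sub, map_sum,
    TensorProduct.map_tmul, tmul_add, tmul_sub, tmul_sum, LinearMap.id_apply,
    Finset.sum_add_distrib, Finset.sum_sub_distrib]
  linear_combination (norm := module) f1 + f2 - f3

lemma qt_co (m : A →ₗ[K] A →ₗ[K] A) (hm : IsPreLie m) (s : Finset (A × A))
    (hr : ∑ p ∈ s, p.1 ⊗ₜ[K] p.2 = ∑ p ∈ s, p.2 ⊗ₜ[K] p.1)
    (hS : IsSEq m (∑ p ∈ s, p.1 ⊗ₜ[K] p.2)) :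
    IsPreLieCo (coprodR m (∑ p ∈ s, p.1 ⊗ₜ[K] p.2)) := by
  intro x
  have hE := seq_canon m s hr hS
  have E1 := congrArg (rTensor (A ⊗[K] A) (m x)) hE
  have E2 := congrArg (lTensor A (rTensor A (m x))) hE
  have E3 := congrArg (lTensor A (lTensor A (m x))) hE
  have E4 := congrArg (lTensor A (lTensor A (m.flip x))) hE
  have pl : ∀ b d, m x (m b d) = m (m x b) d - m (m b x) d + m b (m x d) := by
    intro b d
    have := hm x b d
    linear_combination (norm := module) -this
  have pl2 : ∀ b d, m (m b d) x - m (m d b) x = m b (m d x) - m d (m b x) := by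
    intro b d
    have := hm b d x
    linear_combination (norm := module) this
  have P : ∑ p ∈ s, ∑ q ∈ s, p.1 ⊗ₜ[K] (q.1 ⊗ₜ[K] m (m p.2 q.2) x)
      - ∑ p ∈ s, ∑ q ∈ s, p.1 ⊗ₜ[K] (q.1 ⊗ₜ[K] m (m q.2 p.2) x)
      = ∑ p ∈ s, ∑ q ∈ s, p.1 ⊗ₜ[K] (q.1 ⊗ₜ[K] m p.2 (m q.2 x))
      - ∑ p ∈ s, ∑ q ∈ s, p.1 ⊗ₜ[K] (q.1 ⊗ₜ[K] m q.2 (m p.2 x)) := by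
    simp only [← Finset.sum_sub_distrib, ← tmul_sub, pl2]
  have sw : ∀ G : A → A → A → A → A ⊗[K] (A ⊗[K] A),
      ∑ p ∈ s, ∑ q ∈ s, G p.1 p.2 q.1 q.2 = ∑ p ∈ s, ∑ q ∈ s, G q.1 q.2 p.1 p.2 :=
    fun G => Finset.sum_comm
  have w1 := sw (fun a b c d => c ⊗ₜ[K] (m x a ⊗ₜ[K] m b d))
  have w2 := sw (fun a b c d => c ⊗ₜ[K] (m x a ⊗ₜ[K] m d b))
  have w3 := sw (fun a b c d => c ⊗ₜ[K] (a ⊗ₜ[K] m (m x b) d))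
  have w4 := sw (fun a b c d => c ⊗ₜ[K] (a ⊗ₜ[K] m (m b x) d))
  have w5 := sw (fun a b c d => c ⊗ₜ[K] (a ⊗ₜ[K] m d (m x b)))
  have w6 := sw (fun a b c d => c ⊗ₜ[K] (a ⊗ₜ[K] m d (m b x)))
  rw [coassoc1_canon m s hr, coassoc2_canon m s hr]
  simp only [map_add, map_sub, map_sum, swap12_tmul]
  simp only [map_add, map_sum, rTensor_tmul, lTensor_tmul, LinearMap.flip_apply, pl, tmul_add,
    tmul_sub, add_tmul, sub_tmul, Finset.sum_add_distrib, Finset.sum_sub_distrib]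
    at E1 E2 E3 E4
  linear_combination (norm := module) w1 - w2 + w3 - w4 - w5 + w6 - P - E1 - E2 - E3 + E4

theorem quasitriangular_nijenhuis_bialgebra
    (m : A →ₗ[K] A →ₗ[K] A) (N S : A →ₗ[K] A)
    (hm : IsPreLie m) (hN : IsNijenhuis m N) (hAdm : IsAdmissible m N S)
    (r : A ⊗[K] A) (hr : flipT K A r = r) (hSeq : IsSEq m r)
    (hcond : rTensor A S r = lTensor A N r) :
    IsNijPreLieBialg m (coprodR m r) N S := by
  obtain ⟨s, rfl⟩ := TensorProduct.exists_finset r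
  have hr' : ∑ p ∈ s, p.1 ⊗ₜ[K] p.2 = ∑ p ∈ s, p.2 ⊗ₜ[K] p.1 := by
    rw [← hr]; simp [flipT]
  have hc : ∑ p ∈ s, S p.1 ⊗ₜ[K] p.2 = ∑ p ∈ s, p.1 ⊗ₜ[K] N p.2 := by
    simpa using hcond
  obtain ⟨h1, h2⟩ := qt_nij m N S s hN hAdm hr' hc
  exact ⟨hm, hN, qt_co m hm s hr' hSeq, h1, qt_bialg1 m hm s, qt_bialg2 m hm s hr', hAdm, h2⟩

end Theorems
end
end

section
/- Let (A, ∘, Δ) be a pre-Lie bialgebra over a field K which is commutative (x∘y = y∘x for all x, y ∈ A) and cocommutative (x₍₁₎⊗x₍₂₎ = x₍₂₎⊗x₍₁₎ for all x ∈ A). Then (A, ∘, Δ) is balanced. -/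
open TensorProduct LinearMap

noncomputable section

set_option synthInstance.maxHeartbeats 1000000
set_option maxHeartbeats 1000000

section Theorems

variable {K A V H : Type*} [Field K] [AddCommGroup A] [Module K A]
  [AddCommGroup V] [Module K V] [AddCommGroup H] [Module K H]

theorem commutative_cocommutative_is_balanced
    (m : A →ₗ[K] A →ₗ[K] A) (Δ : A →ₗ[K] A ⊗[K] A)
    (hbialg : IsPreLieBialg m Δ)
    (hcomm : ∀ x y : A, m x y = m y x)
    (hcocomm : ∀ x : A, flipT K A (Δ x) = Δ x) :
    IsBalanced m Δ := by
  have hf : m.flip = m := by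
    ext x y
    exact hcomm y x
  intro x y
  have h := hbialg.2.2.1 x y
  rw [hf, hcomm y x] at h
  have h2 : rTensor A (m x) (Δ y) = rTensor A (m y) (Δ x) := by
    rw [← sub_eq_zero]
    rw [sub_self] at h
    rw [h]
    abel
  rw [hf, h2]

end Theorems
end
end

section
/- Let (A, ∘, Δ) be a pre-Lie bialgebra over a field K. Define [x, y] := x∘y − y∘x and δ(x) := x₍₁₎⊗x₍₂₎ − x₍₂₎⊗x₍₁₎ (with Δ(x) = x₍₁₎⊗x₍₂₎). Then (A, [·,·], δ) is a Lie bialgebra if and only if (A, ∘, Δ) is balanced. -/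
open TensorProduct LinearMap

noncomputable section

set_option synthInstance.maxHeartbeats 1000000
set_option maxHeartbeats 1000000

section Theorems

variable {K A V H : Type*} [Field K] [AddCommGroup A] [Module K A]
  [AddCommGroup V] [Module K V] [AddCommGroup H] [Module K H]

theorem aux_cyc3 (t : A ⊗[K] (A ⊗[K] A)) : cyc K A (cyc K A (cyc K A t)) = t := by
  have h : cyc K A ∘ₗ cyc K A ∘ₗ cyc K A = LinearMap.id := by
    ext a b c
    simp [cyc]
  exact LinearMap.congr_fun h t

theorem aux_flip2 (t : A ⊗[K] A) : flipT K A (flipT K A t) = t := by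
  simp [flipT]

theorem aux_flip_r (f : A →ₗ[K] A) (t : A ⊗[K] A) :
    rTensor A f (flipT K A t) = flipT K A (lTensor A f t) := by
  have h : rTensor A f ∘ₗ flipT K A = flipT K A ∘ₗ lTensor A f := by
    ext a b
    simp [flipT]
  exact LinearMap.congr_fun h t

theorem aux_flip_l (f : A →ₗ[K] A) (t : A ⊗[K] A) :
    lTensor A f (flipT K A t) = flipT K A (rTensor A f t) := by
  have h : lTensor A f ∘ₗ flipT K A = flipT K A ∘ₗ rTensor A f := by
    ext a b
    simp [flipT]
  exact LinearMap.congr_fun h t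

theorem aux_s23 (t : A ⊗[K] (A ⊗[K] A)) :
    lTensor A (flipT K A) t = cyc K A (cyc K A (swap12 K A t)) := by
  have h : lTensor A (flipT K A) = cyc K A ∘ₗ cyc K A ∘ₗ swap12 K A := by
    ext a b c
    simp [cyc, swap12, flipT]
  exact LinearMap.congr_fun h t

theorem aux_s23_cyc (t : A ⊗[K] (A ⊗[K] A)) :
    lTensor A (flipT K A) (cyc K A t) = cyc K A (swap12 K A t) := by
  have h : lTensor A (flipT K A) ∘ₗ cyc K A = cyc K A ∘ₗ swap12 K A := by
    ext a b c
    simp [cyc, swap12, flipT]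
  exact LinearMap.congr_fun h t

theorem aux_flip_co (D : A →ₗ[K] A ⊗[K] A) (t : A ⊗[K] A) :
    lTensor A D (flipT K A t) =
      cyc K A ((TensorProduct.assoc K A A A) (TensorProduct.map D LinearMap.id t)) := by
  have h : lTensor A D ∘ₗ flipT K A = cyc K A ∘ₗ
      (TensorProduct.assoc K A A A).toLinearMap ∘ₗ TensorProduct.map D LinearMap.id := by
    ext a b
    simp [cyc, flipT]
  exact LinearMap.congr_fun h t

theorem aux_coassoc2 (D : A →ₗ[K] A ⊗[K] A) (x : A) :
    coassoc2 (D - flipT K A ∘ₗ D) (D - flipT K A ∘ₗ D) x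
      = coassoc2 D D x - cyc K A (cyc K A (swap12 K A (coassoc2 D D x)))
        - cyc K A (coassoc1 D D x) + cyc K A (swap12 K A (coassoc1 D D x)) := by
  have h1 : coassoc2 (D - flipT K A ∘ₗ D) (D - flipT K A ∘ₗ D) x
      = lTensor A D (D x) - lTensor A (flipT K A) (lTensor A D (D x))
        - (lTensor A D (flipT K A (D x))
          - lTensor A (flipT K A) (lTensor A D (flipT K A (D x)))) := by
    change lTensor A (D - flipT K A ∘ₗ D) (D x - flipT K A (D x)) = _
    simp only [map_sub, lTensor_sub, lTensor_comp, LinearMap.sub_apply, LinearMap.comp_apply]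
  have h2 : lTensor A D (D x) = coassoc2 D D x := rfl
  have h3 : lTensor A D (flipT K A (D x)) = cyc K A (coassoc1 D D x) := aux_flip_co D (D x)
  rw [h1, h3, h2, aux_s23, aux_s23_cyc]
  abel

theorem lie_bialgebra_iff_balanced
    (m : A →ₗ[K] A →ₗ[K] A) (Δ : A →ₗ[K] A ⊗[K] A)
    (hbialg : IsPreLieBialg m Δ) :
    IsLieBialg (m - m.flip) (Δ - flipT K A ∘ₗ Δ) ↔ IsBalanced m Δ := by
  obtain ⟨hm, hc, -, h2⟩ := hbialg
  have hL : IsLieBracket (m - m.flip) := by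
    refine ⟨fun x => by simp, fun x y z => ?_⟩
    have e1 := sub_eq_zero.2 (hm x y z)
    have e2 := sub_eq_zero.2 (hm y z x)
    have e3 := sub_eq_zero.2 (hm z x y)
    simp only [LinearMap.sub_apply, LinearMap.flip_apply, map_sub]
    rw [← add_zero (0 : A), ← add_zero (0 + 0 : A)]
    nth_rewrite 1 [← e1]
    nth_rewrite 1 [← e2]
    nth_rewrite 1 [← e3]
    abel
  have hC : IsLieCobracket (Δ - flipT K A ∘ₗ Δ) := by
    refine ⟨fun x => ?_, fun x => ?_⟩
    · simp only [LinearMap.sub_apply, LinearMap.comp_apply, map_sub, aux_flip2]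
      abel
    · have e := hc x
      rw [aux_coassoc2]
      have e' : coassoc1 Δ Δ x = swap12 K A (coassoc1 Δ Δ x) - swap12 K A (coassoc2 Δ Δ x)
          + coassoc2 Δ Δ x := by rw [← e]; abel
      generalize swap12 K A (coassoc1 Δ Δ x) = p at *
      generalize swap12 K A (coassoc2 Δ Δ x) = q at *
      rw [e']
      simp only [map_sub, map_add, aux_cyc3]
      abel
  have key : ∀ x y : A,
      (Δ - flipT K A ∘ₗ Δ) ((m - m.flip) x y)
        - (rTensor A ((m - m.flip) x) ((Δ - flipT K A ∘ₗ Δ) y)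
          + lTensor A ((m - m.flip) x) ((Δ - flipT K A ∘ₗ Δ) y)
        - rTensor A ((m - m.flip) y) ((Δ - flipT K A ∘ₗ Δ) x)
        - lTensor A ((m - m.flip) y) ((Δ - flipT K A ∘ₗ Δ) x))
      = (rTensor A (m.flip x) (Δ y) + flipT K A (rTensor A (m.flip y) (Δ x)))
        - (rTensor A (m.flip y) (Δ x) + flipT K A (rTensor A (m.flip x) (Δ y))) := by
    intro x y
    have exy := h2 x y
    have eyx := h2 y x
    have e : (Δ - flipT K A ∘ₗ Δ) ((m - m.flip) x y)
      = (Δ (m x y) - flipT K A (Δ (m x y))) - (Δ (m y x) - flipT K A (Δ (m y x))) := by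
      simp only [LinearMap.sub_apply, LinearMap.comp_apply, map_sub, LinearMap.flip_apply]
    rw [e, exy, eyx]
    simp only [LinearMap.sub_apply, LinearMap.comp_apply, map_sub, rTensor_sub, lTensor_sub,
      aux_flip_r, aux_flip_l]
    abel
  constructor
  · rintro ⟨-, -, h⟩ x y
    have k := key x y
    rw [h x y, sub_self] at k
    exact (sub_eq_zero.1 k.symm).symm
  · intro h
    refine ⟨hL, hC, fun x y => ?_⟩
    rw [← sub_eq_zero, key x y, h x y, sub_self]

end Theorems
end
end
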